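/- Let m, n, r be integers with m ≥ 8, n ≥ 8, 2 ≤ r and 2r ≤ mn. Then p_r(m,n) > p_{r−1}(m,n). (Strict unimodality of the Gaussian binomial coefficient, the theorem of Pak and Panova.) -/

import Mathlib

/-- `gaussP m n r` is the number of partitions of `r` into at most `m` parts,
each part of size at most `n` (the coefficient of `q^r` in the Gaussian
binomial coefficient `binom(m+n, m)_q`). -/
def gaussP (m n r : ℕ) : ℕ :=
  (Finset.univ.filter fun f : Fin m → Fin (n + 1) =>
    (∀ i j : Fin m, i ≤ j → f j ≤ f i) ∧ ∑ i, (f i : ℕ) = r).card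

open Polynomial in
/-- Gaussian binomial as a polynomial. -/
noncomputable def qP : ℕ → ℕ → Polynomial ℕ
  | 0, _ => 1
  | _ + 1, 0 => 1
  | m + 1, n + 1 => qP m (n + 1) + X ^ (m + 1) * qP (m + 1) n

section PolyPart
open Polynomial

lemma qP_zero_left (n : ℕ) : qP 0 n = 1 := by simp [qP]
lemma qP_zero_right (m : ℕ) : qP m 0 = 1 := by cases m <;> simp [qP]
lemma qP_succ (m n : ℕ) :
    qP (m + 1) (n + 1) = qP m (n + 1) + X ^ (m + 1) * qP (m + 1) n := by
  rw [qP]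

lemma qP_succ' (m n : ℕ) :
    qP (m + 1) (n + 1) = qP (m + 1) n + X ^ (n + 1) * qP m (n + 1) := by
  induction m generalizing n with
  | zero =>
    induction n with
    | zero => simp [qP_succ, qP_zero_left, qP_zero_right]
    | succ n ih =>
      conv_lhs => rw [qP_succ 0 (n + 1), ih]
      conv_rhs => rw [qP_succ 0 n]
      simp only [qP_zero_left]
      ring
  | succ m ihm =>
    induction n with
    | zero =>
      conv_lhs => rw [qP_succ (m + 1) 0, ihm 0]
      conv_rhs => rw [qP_succ m 0]
      simp only [qP_zero_right]
      ring
    | succ n ihn =>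
      conv_lhs => rw [qP_succ (m + 1) (n + 1), ihm (n + 1), ihn]
      conv_rhs => rw [qP_succ (m + 1) n, qP_succ m (n + 1)]
      ring

lemma qP_symm (m n : ℕ) : qP m n = qP n m := by
  induction m generalizing n with
  | zero => rw [qP_zero_left, qP_zero_right]
  | succ m ihm =>
    induction n with
    | zero => rw [qP_zero_left, qP_zero_right]
    | succ n ihn => rw [qP_succ, ihm, ihn, qP_succ' n m]

lemma qP_coeff_succ (m n r : ℕ) : (qP (m + 1) (n + 1)).coeff r =
    (qP m (n + 1)).coeff r + if m + 1 ≤ r then (qP (m + 1) n).coeff (r - (m + 1)) else 0 := by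
  rw [qP_succ, coeff_add, coeff_X_pow_mul']

lemma qP_coeff_le (m n r : ℕ) : (qP m n).coeff r ≤ 2 ^ (m + n) := by
  induction m generalizing n r with
  | zero =>
    rw [qP_zero_left, coeff_one]
    have := Nat.one_le_two_pow (n := 0 + n)
    split_ifs <;> omega
  | succ m ihm =>
    induction n generalizing r with
    | zero =>
      rw [qP_zero_right, coeff_one]
      have := Nat.one_le_two_pow (n := m + 1 + 0)
      split_ifs <;> omega
    | succ n ihn =>
      rw [qP_coeff_succ]
      have h1 := ihm (n + 1) r
      have h2 := ihn (r - (m + 1))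
      have e1 : 2 ^ (m + (n + 1)) = 2 ^ (m + 1 + n) := by congr 1; omega
      have e2 : 2 ^ (m + 1 + (n + 1)) = 2 * 2 ^ (m + 1 + n) := by rw [← pow_succ']; rfl
      split_ifs <;> omega

lemma digit_eq (B r : ℕ) (p : ℕ[X]) (h : ∀ i, p.coeff i < B) :
    p.eval B / B ^ r % B = p.coeff r := by
  induction r generalizing p with
  | zero =>
    have e : p.eval B = p.divX.eval B * B + p.coeff 0 := by
      conv_lhs => rw [← divX_mul_X_add p]
      simp
    rw [e, pow_zero, Nat.div_one, Nat.mul_add_mod_of_lt (h 0)]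
  | succ r ih =>
    have e : p.eval B = p.divX.eval B * B + p.coeff 0 := by
      conv_lhs => rw [← divX_mul_X_add p]
      simp
    have h0 := h 0
    have hB : 0 < B := by omega
    rw [pow_succ', ← Nat.div_div_eq_div_mul]
    have : p.eval B / B = p.divX.eval B := by
      rw [e, mul_comm, Nat.mul_add_div hB, Nat.div_eq_of_lt h0, add_zero]
    rw [this, ih _ (fun i => by rw [coeff_divX]; exact h _), coeff_divX]

/-- Gaussian binomial evaluated at `2^32`. -/
def qE (n : ℕ) : ℕ → ℕ
  | 0 => 1
  | m + 1 => qE n m * ((2 ^ 32) ^ (n + m + 1) - 1) / ((2 ^ 32) ^ (m + 1) - 1)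

lemma qP_eval_step (m n B : ℕ) (hB : 2 ≤ B) :
    (qP (m + 1) n).eval B * (B ^ (m + 1) - 1) = (qP m n).eval B * (B ^ (n + m + 1) - 1) := by
  have p1 : 1 ≤ B ^ (m + 1) := Nat.one_le_pow _ _ (by omega)
  have p2 : 1 ≤ B ^ (n + m + 1) := Nat.one_le_pow _ _ (by omega)
  cases n with
  | zero => simp [qP_zero_right]
  | succ n =>
    have h1 := congrArg (fun p : ℕ[X] => ((p.eval B : ℕ) : ℤ)) (qP_succ m n)
    have h2 := congrArg (fun p : ℕ[X] => ((p.eval B : ℕ) : ℤ)) (qP_succ' m n)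
    simp only [eval_add, eval_mul, eval_pow, eval_X] at h1 h2
    push_cast at h1 h2
    zify [p1, p2]
    linear_combination (B : ℤ) ^ (m + 1) * h2 - h1

lemma qE_eq (m n : ℕ) : qE n m = (qP m n).eval (2 ^ 32) := by
  induction m with
  | zero => simp [qE, qP_zero_left]
  | succ m ih =>
    rw [qE, ih, ← qP_eval_step m n (2 ^ 32) (by norm_num), Nat.mul_div_cancel]
    have : 1 < (2 ^ 32) ^ (m + 1) := Nat.one_lt_pow (by omega) (by norm_num)
    omega

/-- Check that the digits of `Q` in base `2^32` strictly increase from place `1` to place `k`. -/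
def chk (Q : ℕ) : ℕ → Bool
  | 0 => true
  | 1 => true
  | k + 2 => Nat.blt (Q / (2 ^ 32) ^ (k + 1) % 2 ^ 32) (Q / (2 ^ 32) ^ (k + 2) % 2 ^ 32)
      && chk Q (k + 1)

lemma chk_spec (Q k : ℕ) (h : chk Q k = true) (r : ℕ) (h1 : 2 ≤ r) (h2 : r ≤ k) :
    Q / (2 ^ 32) ^ (r - 1) % 2 ^ 32 < Q / (2 ^ 32) ^ r % 2 ^ 32 := by
  induction k with
  | zero => omega
  | succ k ih =>
    cases k with
    | zero => omega
    | succ k =>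
      rw [chk, Bool.and_eq_true] at h
      rcases Nat.lt_or_ge r (k + 1 + 1) with hr | hr
      · exact ih h.2 (by omega)
      · obtain rfl : r = k + 2 := by omega
        have := h.1
        rw [Nat.blt_eq] at this
        exact this

/-- All base cases. -/
def chkAll : Bool :=
  (List.range 8).all fun a => (List.range 8).all fun b =>
    chk (qE (b + 8) (a + 8)) ((a + 8) * (b + 8) / 2)

set_option maxRecDepth 100000 in
lemma chkAll_true : chkAll = true := by decide +kernel

lemma base_case (m n r : ℕ) (hm : 8 ≤ m) (hn : 8 ≤ n) (hm' : m < 16) (hn' : n < 16)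
    (hr1 : 2 ≤ r) (hr2 : 2 * r ≤ m * n) : (qP m n).coeff (r - 1) < (qP m n).coeff r := by
  have h := chkAll_true
  simp only [chkAll, List.all_eq_true, List.mem_range] at h
  have h := h (m - 8) (by omega) (n - 8) (by omega)
  rw [show m - 8 + 8 = m by omega, show n - 8 + 8 = n by omega] at h
  have h := chk_spec _ _ h r hr1 (by omega)
  have hb : ∀ i, (qP m n).coeff i < 2 ^ 32 := fun i =>
    (qP_coeff_le m n i).trans_lt (Nat.pow_lt_pow_right (by norm_num) (by omega))
  rw [qE_eq, digit_eq _ _ _ hb, digit_eq _ _ _ hb] at h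
  exact h
end PolyPart
section SlTwo
open MvPolynomial

/-- Bidegree of the variables. -/
def wt (n : ℕ) (i : Fin (n + 1)) : ℤ × ℤ := (1, (i : ℤ))

lemma mkDer_homog {σ : Type*} {M : Type*} [AddCommMonoid M] (w : σ → M) (δ : M)
    (f : σ → MvPolynomial σ ℚ) (hf : ∀ i, IsWeightedHomogeneous w (f i) (w i + δ))
    (k : M) (p : MvPolynomial σ ℚ) (hp : IsWeightedHomogeneous w p k) :
    IsWeightedHomogeneous w (mkDerivation ℚ f p) (k + δ) := by
  induction hp using IsWeightedHomogeneous.induction_on with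
  | zero => rw [map_zero]; exact isWeightedHomogeneous_zero _ _ _
  | add p q hp hq h1 h2 => rw [map_add]; exact h1.add h2
  | monomial d r hr =>
    rw [mkDerivation_monomial, smul_eq_C_mul]
    refine IsWeightedHomogeneous.C_mul ?_ _
    refine IsWeightedHomogeneous.sum _ _ _ ?_
    intro i hi
    have hi' : d i ≠ 0 := by simpa using hi
    have h := Finsupp.weight_sub_single_add (w := w) hi'
    change IsWeightedHomogeneous w (monomial (d - Finsupp.single i 1) (d i : ℚ) * f i) _
    have h2 := (isWeightedHomogeneous_monomial w (d - Finsupp.single i 1) (d i : ℚ) rfl).mul (hf i)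
    rw [← add_assoc, h, hr] at h2
    exact h2

/-- lowering on variables -/
noncomputable def fD (n : ℕ) (i : Fin (n + 1)) : MvPolynomial (Fin (n + 1)) ℚ :=
  C ((i : ℕ) : ℚ) * X ⟨(i : ℕ) - 1, by omega⟩
/-- raising on variables -/
noncomputable def fU (n : ℕ) (i : Fin (n + 1)) : MvPolynomial (Fin (n + 1)) ℚ :=
  C ((n : ℚ) - ((i : ℕ) : ℚ)) * X ⟨min ((i : ℕ) + 1) n, by omega⟩
/-- diagonal on variables -/
noncomputable def fH (n : ℕ) (i : Fin (n + 1)) : MvPolynomial (Fin (n + 1)) ℚ :=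
  C ((n : ℚ) - 2 * ((i : ℕ) : ℚ)) * X i

/-- lowering derivation -/
noncomputable def opD (n : ℕ) := mkDerivation ℚ (fD n)
/-- raising derivation -/
noncomputable def opU (n : ℕ) := mkDerivation ℚ (fU n)

lemma comm_DU (n : ℕ) (p : MvPolynomial (Fin (n + 1)) ℚ) :
    opD n (opU n p) = opU n (opD n p) + mkDerivation ℚ (fH n) p := by
  have h : ⁅opD n, opU n⁆ = mkDerivation ℚ (fH n) := by
    apply derivation_ext
    intro i
    rw [Derivation.commutator_apply, mkDerivation_X]
    simp only [opD, opU, mkDerivation_X, fD, fU, fH, Derivation.leibniz, derivation_C, smul_zero,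
      add_zero, smul_eq_mul]
    obtain ⟨i, hi⟩ := i
    rcases Nat.lt_or_ge i n with h | h
    · have e1 : min (i + 1) n = i + 1 := by omega
      rcases Nat.eq_zero_or_pos i with h0 | h0
      · subst h0
        simp only [e1]
        simp
      · have e2 : i - 1 + 1 = i := by omega
        have e3 : min (i - 1 + 1) n = i := by omega
        have e4 : ((i - 1 : ℕ) : ℚ) = i - 1 := by rw [Nat.cast_sub h0]; simp
        simp only [e1, e3, e4, Nat.add_sub_cancel]
        push_cast
        simp only [map_sub, map_add, map_mul, map_one]
        rw [show (C (2 : ℚ) : MvPolynomial (Fin (n + 1)) ℚ) = 2 from rfl]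
        ring
    · obtain rfl : i = n := by omega
      rcases Nat.eq_zero_or_pos i with h0 | h0
      · subst h0
        simp
      · have e3 : min (i - 1 + 1) i = i := by omega
        have e4 : ((i - 1 : ℕ) : ℚ) = i - 1 := by rw [Nat.cast_sub h0]; simp
        simp only [e3, e4]
        simp only [map_sub, map_mul, map_one]
        rw [show (C (2 : ℚ) : MvPolynomial (Fin (i + 1)) ℚ) = 2 from rfl]
        ring
  rw [← h, Derivation.commutator_apply]
  ring

lemma weight_wt (n : ℕ) (d : Fin (n + 1) →₀ ℕ) :
    Finsupp.weight (wt n) d = (((∑ i, d i : ℕ) : ℤ), ((∑ i : Fin (n + 1), (i : ℕ) * d i : ℕ) : ℤ)) := by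
  rw [Finsupp.weight_apply, Finsupp.sum_fintype _ _ (by simp)]
  ext
  · simp [wt, Prod.fst_sum]
  · simp [wt, Prod.snd_sum, mul_comm]

/-- weight spaces -/
noncomputable abbrev wsp (n : ℕ) (m r : ℤ) := weightedHomogeneousSubmodule ℚ (wt n) (m, r)

lemma opD_mem {n : ℕ} {m r : ℤ} {p} (hp : p ∈ wsp n m r) : opD n p ∈ wsp n m (r - 1) := by
  have := mkDer_homog (wt n) (0, -1) (fD n) (fun i => by
    rcases Nat.eq_zero_or_pos (i : ℕ) with h | h
    · simp only [fD, h, Nat.cast_zero, map_zero, zero_mul]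
      exact isWeightedHomogeneous_zero _ _ _
    · refine IsWeightedHomogeneous.C_mul ?_ _
      have := isWeightedHomogeneous_X ℚ (wt n) ⟨(i : ℕ) - 1, by omega⟩
      have e : wt n i + (0, -1) = wt n ⟨(i : ℕ) - 1, by omega⟩ := by
        apply Prod.ext
        · simp [wt]
        · change ((i : ℕ) : ℤ) + -1 = (((i : ℕ) - 1 : ℕ) : ℤ)
          omega
      rw [e]
      exact this) (m, r) p hp
  rw [Prod.mk_add_mk, add_zero, ← sub_eq_add_neg] at this
  exact this

lemma opU_mem {n : ℕ} {m r : ℤ} {p} (hp : p ∈ wsp n m r) : opU n p ∈ wsp n m (r + 1) := by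
  have := mkDer_homog (wt n) (0, 1) (fU n) (fun i => by
    rcases Nat.lt_or_ge (i : ℕ) n with h | h
    · refine IsWeightedHomogeneous.C_mul ?_ _
      have := isWeightedHomogeneous_X ℚ (wt n) ⟨min ((i : ℕ) + 1) n, by omega⟩
      have e : wt n i + (0, 1) = wt n ⟨min ((i : ℕ) + 1) n, by omega⟩ := by
        apply Prod.ext
        · simp [wt]
        · change ((i : ℕ) : ℤ) + 1 = ((min ((i : ℕ) + 1) n : ℕ) : ℤ)
          omega
      rw [e]
      exact this
    · have : (i : ℕ) = n := by omega
      simp only [fU, this, sub_self, map_zero, zero_mul]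
      exact isWeightedHomogeneous_zero _ _ _) (m, r) p hp
  rw [Prod.mk_add_mk, add_zero] at this
  exact this

lemma opH_eq {n : ℕ} {m r : ℤ} {p} (hp : p ∈ wsp n m r) :
    mkDerivation ℚ (fH n) p = ((m * n - 2 * r : ℤ) : ℚ) • p := by
  replace hp : IsWeightedHomogeneous (wt n) p (m, r) := hp
  induction hp using IsWeightedHomogeneous.induction_on with
  | zero => simp
  | add p q hp hq h1 h2 => rw [map_add, h1, h2, smul_add]
  | monomial d c hr =>
    rw [weight_wt, Prod.mk.injEq] at hr
    obtain ⟨h1, h2⟩ := hr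
    rw [mkDerivation_monomial]
    have key : (d.sum fun i k => monomial (d - Finsupp.single i 1) (k : ℚ) • fH n i) =
        d.sum fun i k => monomial d ((k : ℚ) * (n - 2 * ((i : ℕ) : ℚ))) := by
      refine Finset.sum_congr rfl fun i hi => ?_
      have hi' : d i ≠ 0 := by simpa using hi
      change monomial (d - Finsupp.single i 1) (d i : ℚ) *
        (C ((n : ℚ) - 2 * ((i : ℕ) : ℚ)) * X i) = monomial d _
      rw [X, C_mul_monomial, monomial_mul, mul_one]
      rw [Finsupp.sub_add_single_one_cancel hi']
    rw [key, Finsupp.sum_fintype _ _ (by simp), ← map_sum, ← map_smul, ← map_smul]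
    congr 1
    simp only [smul_eq_mul]
    rw [mul_comm]
    congr 1
    rw [← h1, ← h2]
    push_cast
    rw [Finset.sum_mul, Finset.mul_sum, ← Finset.sum_sub_distrib]
    exact Finset.sum_congr rfl fun i _ => by ring

lemma wsp_neg {n : ℕ} {m r : ℤ} (hr : r < 0) {p} (hp : p ∈ wsp n m r) : p = 0 := by
  refine IsWeightedHomogeneous.eq_zero_of_no_monomials hp ?_
  intro d hd
  rw [weight_wt, Prod.mk.injEq] at hd
  omega

lemma inj_aux (n m : ℕ) (s : ℕ) : 2 * s ≤ m * n → ∀ (l : ℚ), 0 < l → ∀ g ∈ wsp n m s,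
    opU n (opD n g) + l • g = 0 → g = 0 := by
  induction s with
  | zero =>
    intro _ l hl g hg h
    have h0 : opD n g = 0 := wsp_neg (by simp) (opD_mem hg)
    rw [h0, map_zero, zero_add] at h
    exact (smul_eq_zero.mp h).resolve_left hl.ne'
  | succ s ih =>
    intro hs l hl g hg h
    have hg' := opD_mem hg
    rw [show ((s + 1 : ℕ) : ℤ) - 1 = s by push_cast; ring] at hg'
    have h1 := congrArg (opD n) h
    rw [map_add, comm_DU, opH_eq hg', map_zero, Derivation.map_smul, add_assoc, ← add_smul] at h1
    have hpos : (0 : ℚ) ≤ (((m : ℤ) * n - 2 * s : ℤ) : ℚ) := by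
      have : (2 * s : ℤ) ≤ m * n := by exact_mod_cast (by omega : 2 * s ≤ m * n)
      exact Int.cast_nonneg (by omega)
    have h0 := ih (by omega) _ (by linarith) _ hg' h1
    rw [h0, map_zero, zero_add] at h
    exact (smul_eq_zero.mp h).resolve_left hl.ne'

lemma DU_inj (n m s : ℕ) (hs : 2 * s < m * n) (g) (hg : g ∈ wsp n m s)
    (h : opD n (opU n g) = 0) : g = 0 := by
  rw [comm_DU, opH_eq hg] at h
  refine inj_aux n m s hs.le _ ?_ g hg h
  have : (2 * s : ℤ) < m * n := by exact_mod_cast hs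
  exact Int.cast_pos.mpr (by omega)

lemma wset_finite (n m r : ℕ) :
    {d : Fin (n + 1) →₀ ℕ | Finsupp.weight (wt n) d = ((m : ℤ), (r : ℤ))}.Finite := by
  refine (Set.finite_Iic (Finsupp.equivFunOnFinite.symm (fun _ : Fin (n + 1) => m))).subset ?_
  intro d hd i
  simp only [Set.mem_ofPred_eq, weight_wt, Prod.mk.injEq] at hd
  have h1 : ∑ i, d i = m := by exact_mod_cast hd.1
  simp only [Finsupp.equivFunOnFinite_symm_apply_apply]
  rw [← h1]
  exact Finset.single_le_sum (f := fun i => d i) (fun _ _ => Nat.zero_le _) (Finset.mem_univ i)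

instance wsp_fd (n m r : ℕ) : FiniteDimensional ℚ (wsp n m r) := by
  rw [wsp, weightedHomogeneousSubmodule_eq_finsupp_supported]
  have := (wset_finite n m r).to_subtype
  exact Module.Finite.of_basis (basisRestrictSupport ℚ _)

lemma wsp_finrank (n m r : ℕ) : Module.finrank ℚ (wsp n m r) =
    {d : Fin (n + 1) →₀ ℕ | Finsupp.weight (wt n) d = ((m : ℤ), (r : ℤ))}.ncard := by
  rw [wsp, weightedHomogeneousSubmodule_eq_finsupp_supported]
  exact Module.finrank_eq_nat_card_basis (basisRestrictSupport ℚ _)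

/-- existence of a nonzero highest weight vector -/
def HW (n m r : ℕ) : Prop := ∃ f ∈ wsp n m r, f ≠ 0 ∧ opD n f = 0

lemma HW_add {n m m' r r' : ℕ} (h : HW n m r) (h' : HW n m' r') : HW n (m + m') (r + r') := by
  obtain ⟨f, hf, hf0, hfD⟩ := h
  obtain ⟨g, hg, hg0, hgD⟩ := h'
  refine ⟨f * g, ?_, mul_ne_zero hf0 hg0, ?_⟩
  · have := IsWeightedHomogeneous.mul hf hg
    push_cast
    exact this
  · rw [Derivation.leibniz, hfD, hgD, smul_zero, smul_zero, add_zero]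

lemma HW_zero (n m : ℕ) : HW n m 0 := by
  refine ⟨X 0 ^ m, ?_, pow_ne_zero _ (X_ne_zero _), ?_⟩
  · have := (isWeightedHomogeneous_X ℚ (wt n) 0).pow m
    simpa [wt] using this
  · rw [Derivation.leibniz_pow, opD, mkDerivation_X]
    simp [fD]

lemma HW_iff (n m r : ℕ) (h : 2 * (r + 1) ≤ m * n) : HW n m (r + 1) ↔
    Module.finrank ℚ (wsp n m r) < Module.finrank ℚ (wsp n m (r + 1 : ℕ)) := by
  constructor
  · rintro ⟨f, hf, hf0, hfD⟩
    have hinj : Function.Injective ((opU n).toLinearMap.domRestrict (wsp n m r)) := by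
      rw [injective_iff_map_eq_zero]
      rintro ⟨g, hg⟩ h0
      have h0 : opU n g = 0 := h0
      have := DU_inj n m r (by omega) g hg (by rw [h0, map_zero])
      exact Subtype.ext this
    rw [← LinearMap.finrank_range_of_inj hinj]
    apply Submodule.finrank_lt_finrank_of_lt
    rw [SetLike.lt_iff_le_and_exists]
    constructor
    · rintro _ ⟨⟨g, hg⟩, rfl⟩
      have := opU_mem hg
      push_cast
      exact this
    · refine ⟨f, hf, ?_⟩
      rintro ⟨⟨g, hg⟩, hgf⟩
      have hgf : opU n g = f := hgf
      have := DU_inj n m r (by omega) g hg (by rw [hgf, hfD])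
      rw [this, map_zero] at hgf
      exact hf0 hgf.symm
  · intro hlt
    have hm : ∀ p ∈ wsp n m (r + 1 : ℕ), (opD n).toLinearMap p ∈ wsp n m r := by
      intro p hp
      have := opD_mem hp
      rw [show ((r + 1 : ℕ) : ℤ) - 1 = r by push_cast; ring] at this
      exact this
    have hk := LinearMap.ker_ne_bot_of_finrank_lt
      (f := (opD n).toLinearMap.restrict hm) hlt
    obtain ⟨⟨f, hf⟩, hfk, hf0⟩ := Submodule.exists_mem_ne_zero_of_ne_bot hk
    refine ⟨f, hf, fun h => hf0 (Subtype.ext h), ?_⟩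
    exact congrArg Subtype.val (LinearMap.mem_ker.mp hfk)
end SlTwo

section Count

/-- exponent vectors -/
def Eset (m n r : ℕ) : Set (Fin (n + 1) → ℕ) :=
  {d | ∑ i, d i = m ∧ ∑ i : Fin (n + 1), (i : ℕ) * d i = r}

lemma Eset_finite (m n r : ℕ) : (Eset m n r).Finite := by
  refine (Set.finite_Iic (fun _ : Fin (n + 1) => m)).subset ?_
  rintro d ⟨h1, -⟩ i
  rw [← h1]
  exact Finset.single_le_sum (f := fun i => d i) (fun _ _ => Nat.zero_le _) (Finset.mem_univ i)

lemma Eset_succ (m n r : ℕ) : Eset (m + 1) (n + 1) r =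
    (fun d => d + Pi.single 0 1) '' Eset m (n + 1) r ∪
    (fun d : Fin (n + 1) → ℕ => (Fin.cons 0 d : Fin (n + 2) → ℕ)) ''
      {d | ∑ i, d i = m + 1 ∧ ∑ i : Fin (n + 1), (i : ℕ) * d i + (m + 1) = r} := by
  ext d
  constructor
  · rintro ⟨h1, h2⟩
    rcases Nat.eq_zero_or_pos (d 0) with h | h
    · right
      refine ⟨Fin.tail d, ⟨?_, ?_⟩, ?_⟩
      · rw [Fin.sum_univ_succ, h, zero_add] at h1
        exact h1
      · rw [Fin.sum_univ_succ, h, zero_add] at h1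
        rw [Fin.sum_univ_succ] at h2
        simp only [Fin.val_succ, Fin.val_zero, zero_mul, zero_add, add_mul, one_mul,
          Finset.sum_add_distrib, h1] at h2
        exact h2
      · change (Fin.cons 0 (Fin.tail d) : Fin (n + 2) → ℕ) = d
        rw [← h]
        exact Fin.cons_self_tail d
    · left
      refine ⟨d - Pi.single 0 1, ⟨?_, ?_⟩, ?_⟩
      · rw [Fin.sum_univ_succ] at h1 ⊢
        simp
        omega
      · rw [Fin.sum_univ_succ] at h2 ⊢
        simpa using h2
      · funext i
        refine Fin.cases ?_ (fun j => ?_) i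
        · simp
          omega
        · simp
  · rintro (⟨e, ⟨h1, h2⟩, rfl⟩ | ⟨e, ⟨h1, h2⟩, rfl⟩)
    · constructor
      · rw [← h1, Fin.sum_univ_succ, Fin.sum_univ_succ (f := e)]
        simp
        omega
      · rw [← h2, Fin.sum_univ_succ, Fin.sum_univ_succ (n := n + 1)]
        simp
    · constructor
      · rw [Fin.sum_univ_succ]
        simpa using h1
      · rw [Fin.sum_univ_succ, ← h2, ← h1]
        simp [add_mul, Finset.sum_add_distrib]

lemma shift_ncard (m n r : ℕ) :
    {d : Fin (n + 1) → ℕ | ∑ i, d i = m + 1 ∧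
      ∑ i : Fin (n + 1), (i : ℕ) * d i + (m + 1) = r}.ncard =
    if m + 1 ≤ r then (Eset (m + 1) n (r - (m + 1))).ncard else 0 := by
  split_ifs with h
  · congr 1
    ext d
    simp only [Eset, Set.mem_ofPred_eq]
    constructor <;> rintro ⟨h1, h2⟩ <;> exact ⟨h1, by omega⟩
  · refine Eq.trans (congrArg Set.ncard ?_) (Set.ncard_empty _)
    ext d
    simp only [Set.mem_ofPred_eq, Set.mem_empty_iff_false, iff_false]
    rintro ⟨h1, h2⟩
    omega

lemma Eset_ncard (m n r : ℕ) : (Eset m n r).ncard = (qP m n).coeff r := by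
  induction m generalizing n r with
  | zero =>
    rw [qP_zero_left, Polynomial.coeff_one]
    split_ifs with h
    · subst h
      rw [Set.ncard_eq_one]
      refine ⟨0, ?_⟩
      ext d
      simp only [Eset, Set.mem_ofPred_eq, Set.mem_singleton_iff]
      constructor
      · rintro ⟨h1, -⟩
        funext i
        exact (Finset.sum_eq_zero_iff.mp h1) i (Finset.mem_univ i)
      · rintro rfl
        simp
    · refine Eq.trans (congrArg Set.ncard ?_) (Set.ncard_empty _)
      ext d
      simp only [Eset, Set.mem_ofPred_eq, Set.mem_empty_iff_false, iff_false]
      rintro ⟨h1, h2⟩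
      apply h
      rw [← h2]
      apply Finset.sum_eq_zero
      intro i hi
      rw [(Finset.sum_eq_zero_iff.mp h1) i hi, mul_zero]
  | succ m ihm =>
    induction n generalizing r with
    | zero =>
      rw [qP_zero_right, Polynomial.coeff_one]
      split_ifs with h
      · subst h
        rw [Set.ncard_eq_one]
        refine ⟨fun _ => m + 1, ?_⟩
        ext d
        simp [Eset, funext_iff, Fin.forall_fin_one]
      · refine Eq.trans (congrArg Set.ncard ?_) (Set.ncard_empty _)
        ext d
        simp [Eset]
        omega
    | succ n ihn =>
      have hf := Eset_finite (m + 1) (n + 1) r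
      rw [Eset_succ] at hf
      rw [Eset_succ, Set.ncard_union_eq _ (hf.subset Set.subset_union_left)
        (hf.subset Set.subset_union_right), Set.ncard_image_of_injective _ (add_left_injective _),
        Set.ncard_image_of_injective _ (Fin.cons_right_injective (α := fun _ => ℕ) 0), ihm,
        shift_ncard, ihn, qP_coeff_succ]
      rw [Set.disjoint_left]
      rintro _ ⟨d, -, rfl⟩ ⟨e, -, he⟩
      have := congrFun he 0
      simp at this

lemma finrank_coeff (m n r : ℕ) : Module.finrank ℚ (wsp n m r) = (qP m n).coeff r := by
  rw [wsp_finrank, ← Eset_ncard]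
  rw [← Set.ncard_image_of_injective _ (DFunLike.coe_injective (F := Fin (n + 1) →₀ ℕ))]
  congr 1
  ext d
  simp only [Set.mem_image, Set.mem_ofPred_eq, Eset, weight_wt, Prod.mk.injEq, Nat.cast_inj]
  constructor
  · rintro ⟨e, h, rfl⟩
    exact h
  · intro h
    exact ⟨Finsupp.equivFunOnFinite.symm d, h, rfl⟩

/-- partitions in a box -/
def Gset (m n r : ℕ) : Set (Fin m → ℕ) :=
  {f | (∀ i j, i ≤ j → f j ≤ f i) ∧ (∀ i, f i ≤ n) ∧ ∑ i, f i = r}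

lemma Gset_finite (m n r : ℕ) : (Gset m n r).Finite :=
  (Set.finite_Iic (fun _ : Fin m => n)).subset fun _ h => h.2.1

lemma gaussP_eq_ncard (m n r : ℕ) : gaussP m n r = (Gset m n r).ncard := by
  have hinj : Function.Injective (fun (f : Fin m → Fin (n + 1)) (i : Fin m) => ((f i : ℕ))) := by
    intro f g h
    funext i
    exact Fin.ext (congrFun h i)
  rw [gaussP, ← Set.ncard_coe_finset, ← Set.ncard_image_of_injective _ hinj]
  congr 1
  ext f
  simp only [Set.mem_image, Finset.coe_filter, Finset.mem_univ, true_and, Set.mem_ofPred_eq, Gset]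
  constructor
  · rintro ⟨g, ⟨h1, h2⟩, rfl⟩
    exact ⟨fun i j h => h1 i j h, fun i => Nat.le_of_lt_succ (g i).2, h2⟩
  · rintro ⟨h1, h2, h3⟩
    exact ⟨fun i => ⟨f i, Nat.lt_succ_of_le (h2 i)⟩, ⟨fun i j h => h1 i j h, h3⟩, rfl⟩

lemma Gset_succ (m n r : ℕ) : Gset (m + 1) (n + 1) r =
    (fun f : Fin m → ℕ => (Fin.snoc f 0 : Fin (m + 1) → ℕ)) '' Gset m (n + 1) r ∪
    (fun f => f + 1) '' {f | (∀ i j, i ≤ j → f j ≤ f i) ∧ (∀ i, f i ≤ n) ∧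
      ∑ i, f i + (m + 1) = r} := by
  ext f
  constructor
  · rintro ⟨h1, h2, h3⟩
    rcases Nat.eq_zero_or_pos (f (Fin.last m)) with h | h
    · left
      refine ⟨Fin.init f, ⟨fun i j hij => h1 _ _ (by simpa using hij), fun i => h2 _, ?_⟩, ?_⟩
      · rw [Fin.sum_univ_castSucc, h, add_zero] at h3
        exact h3
      · change (Fin.snoc (Fin.init f) 0 : Fin (m + 1) → ℕ) = f
        rw [← h]
        exact Fin.snoc_init_self f
    · right
      have hp : ∀ i, 1 ≤ f i := fun i => le_trans h (h1 i _ (Fin.le_last i))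
      have e : (fun i => f i - 1) + 1 = f := by
        funext i
        have := hp i
        simp
        omega
      refine ⟨fun i => f i - 1, ⟨fun i j hij => ?_, fun i => ?_, ?_⟩, e⟩
      · have := h1 i j hij
        dsimp only
        omega
      · have := h2 i
        dsimp only
        omega
      · rw [← h3]
        conv_rhs => rw [← e]
        simp [Finset.sum_add_distrib]
  · rintro (⟨e, ⟨h1, h2, h3⟩, rfl⟩ | ⟨e, ⟨h1, h2, h3⟩, rfl⟩)
    · refine ⟨fun i j hij => ?_, fun i => ?_, ?_⟩
      · induction j using Fin.lastCases with
        | last => simp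
        | cast j =>
          induction i using Fin.lastCases with
          | last =>
            exfalso
            have := Fin.le_def.mp hij
            simp at this
            omega
          | cast i =>
            simp only [Fin.snoc_castSucc]
            exact h1 i j (by simpa using hij)
      · induction i using Fin.lastCases with
        | last => simp
        | cast i => simpa using h2 i
      · rw [Fin.sum_univ_castSucc]
        simpa using h3
    · refine ⟨fun i j hij => ?_, fun i => ?_, ?_⟩
      · simpa using h1 i j hij
      · simpa using h2 i
      · rw [← h3]
        simp [Finset.sum_add_distrib]

lemma shift_ncard' (m n r : ℕ) :
    {f : Fin (m + 1) → ℕ | (∀ i j, i ≤ j → f j ≤ f i) ∧ (∀ i, f i ≤ n) ∧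
      ∑ i, f i + (m + 1) = r}.ncard =
    if m + 1 ≤ r then (Gset (m + 1) n (r - (m + 1))).ncard else 0 := by
  split_ifs with h
  · congr 1
    ext d
    simp only [Gset, Set.mem_ofPred_eq]
    constructor <;> rintro ⟨h1, h2, h3⟩ <;> exact ⟨h1, h2, by omega⟩
  · refine Eq.trans (congrArg Set.ncard ?_) (Set.ncard_empty _)
    ext d
    simp only [Set.mem_ofPred_eq, Set.mem_empty_iff_false, iff_false]
    rintro ⟨h1, h2, h3⟩
    omega

lemma Gset_ncard (m n r : ℕ) : (Gset m n r).ncard = (qP m n).coeff r := by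
  induction m generalizing n r with
  | zero =>
    rw [qP_zero_left, Polynomial.coeff_one]
    split_ifs with h
    · subst h
      rw [Set.ncard_eq_one]
      refine ⟨0, ?_⟩
      ext d
      simp [Gset, funext_iff]
    · refine Eq.trans (congrArg Set.ncard ?_) (Set.ncard_empty _)
      ext d
      simp [Gset]
      omega
  | succ m ihm =>
    induction n generalizing r with
    | zero =>
      rw [qP_zero_right, Polynomial.coeff_one]
      split_ifs with h
      · subst h
        rw [Set.ncard_eq_one]
        refine ⟨0, ?_⟩
        ext d
        simp only [Gset, Set.mem_ofPred_eq, Set.mem_singleton_iff]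
        constructor
        · rintro ⟨-, h, -⟩
          funext i
          exact Nat.le_zero.mp (h i)
        · rintro rfl
          simp
      · refine Eq.trans (congrArg Set.ncard ?_) (Set.ncard_empty _)
        ext d
        simp only [Gset, Set.mem_ofPred_eq, Set.mem_empty_iff_false, iff_false]
        rintro ⟨-, h2, h3⟩
        apply h
        rw [← h3]
        exact Finset.sum_eq_zero fun i _ => Nat.le_zero.mp (h2 i)
    | succ n ihn =>
      have hf := Gset_finite (m + 1) (n + 1) r
      rw [Gset_succ] at hf
      have hinj : Function.Injective
          (fun f : Fin m → ℕ => (Fin.snoc f 0 : Fin (m + 1) → ℕ)) := by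
        intro f g h
        funext i
        simpa using congrFun h (Fin.castSucc i)
      rw [Gset_succ, Set.ncard_union_eq _ (hf.subset Set.subset_union_left)
        (hf.subset Set.subset_union_right), Set.ncard_image_of_injective _ hinj,
        Set.ncard_image_of_injective _ (add_left_injective _), ihm,
        shift_ncard', ihn, qP_coeff_succ]
      rw [Set.disjoint_left]
      rintro _ ⟨d, -, rfl⟩ ⟨e, -, he⟩
      have := congrFun he (Fin.last m)
      simp at this

end Count

lemma HW_iff_coeff (n m r : ℕ) (h1 : 1 ≤ r) (h : 2 * r ≤ m * n) :
    HW n m r ↔ (qP m n).coeff (r - 1) < (qP m n).coeff r := by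
  obtain ⟨r, rfl⟩ : ∃ s, r = s + 1 := ⟨r - 1, by omega⟩
  rw [HW_iff n m r h, finrank_coeff, finrank_coeff]
  rfl

/-- Extending strictness from `8 ≤ m < 16` to all `8 ≤ m`. -/
lemma extend (n : ℕ) (hn : 8 ≤ n)
    (hb : ∀ m, 8 ≤ m → m < 16 → ∀ r, 2 ≤ r → 2 * r ≤ m * n → HW n m r) (m : ℕ) :
    8 ≤ m → ∀ r, 2 ≤ r → 2 * r ≤ m * n → HW n m r := by
  induction m using Nat.strong_induction_on with
  | _ m ih =>
    intro hm r hr1 hr2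
    rcases Nat.lt_or_ge m 16 with h | h
    · exact hb m hm h r hr1 hr2
    · obtain ⟨k, rfl⟩ : ∃ k, m = 8 + k := ⟨m - 8, by omega⟩
      have ihk := ih k (by omega) (by omega)
      have h8 := hb 8 le_rfl (by norm_num)
      rw [add_mul] at hr2
      have hkn : 64 ≤ k * n := Nat.mul_le_mul (by omega : 8 ≤ k) hn
      generalize hK : k * n = K at *
      by_cases c1 : 2 * r ≤ K
      · have := HW_add (HW_zero n 8) (ihk r hr1 c1)
        rwa [zero_add] at this
      · by_cases c2 : r = K / 2 + 1
        · have := HW_add (h8 2 le_rfl (by omega)) (ihk (r - 2) (by omega) (by omega))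
          rwa [show 2 + (r - 2) = r by omega] at this
        · have := HW_add (h8 (r - K / 2) (by omega) (by omega)) (ihk (K / 2) (by omega) (by omega))
          rwa [show r - K / 2 + K / 2 = r by omega] at this


/-- Strict unimodality of the Gaussian binomial coefficient (Pak–Panova). -/
theorem stmt1 (m n r : ℕ) (hm : 8 ≤ m) (hn : 8 ≤ n)
    (hr1 : 2 ≤ r) (hr2 : 2 * r ≤ m * n) :
    gaussP m n (r - 1) < gaussP m n r := by
  rw [gaussP_eq_ncard, gaussP_eq_ncard, Gset_ncard, Gset_ncard]
  have step : ∀ n, 8 ≤ n → n < 16 → ∀ m, 8 ≤ m → ∀ r, 2 ≤ r → 2 * r ≤ m * n → HW n m r := by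
    intro n hn hn' m
    refine extend n hn (fun m hm hm' r hr1 hr2 => ?_) m
    rw [HW_iff_coeff n m r (by omega) hr2]
    exact base_case m n r hm hn hm' hn' hr1 hr2
  rw [← HW_iff_coeff n m r (by omega) hr2]
  refine extend n hn (fun m hm hm' r hr1 hr2 => ?_) m hm r hr1 hr2
  rw [HW_iff_coeff n m r (by omega) hr2, qP_symm,
    ← HW_iff_coeff m n r (by omega) (by rwa [mul_comm n m])]
  exact step m hm hm' n hn r hr1 (by rwa [mul_comm n m])
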